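/- Let A, B be positive definite matrices and 1 ≤ p ≤ 2. Set μ = ((A^p + B^p)/2)^(1/p). Then the cosine of the angle between A and μ is at least the cosine of the angle between A and B: (trace(Aμ))² · trace(A²) · trace(B²) ≥ (trace(AB))² · trace(A²) · trace(μ²), equivalently (trace(AB))² · trace(μ²) ≤ trace(B²) · (trace(Aμ))². -/

import Mathlib

open Matrix MeasureTheory
open scoped ComplexOrder

/-- Apply a real function to a Hermitian matrix via the spectral decomposition. -/
noncomputable def matFun {n : ℕ} (A : Matrix (Fin n) (Fin n) ℂ) (hA : A.IsHermitian)
    (g : ℝ → ℝ) : Matrix (Fin n) (Fin n) ℂ :=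
  (hA.eigenvectorUnitary : Matrix (Fin n) (Fin n) ℂ) *
    Matrix.diagonal (fun i => (g (hA.eigenvalues i) : ℂ)) *
    star (hA.eigenvectorUnitary : Matrix (Fin n) (Fin n) ℂ)

/-- Real power of a Hermitian matrix via the spectral decomposition. -/
noncomputable def mpow {n : ℕ} (A : Matrix (Fin n) (Fin n) ℂ) (hA : A.IsHermitian)
    (p : ℝ) : Matrix (Fin n) (Fin n) ℂ :=
  matFun A hA (fun x => x ^ p)

/-- Hilbert-Schmidt (Frobenius) norm of a matrix. -/
noncomputable def frob {n : ℕ} (X : Matrix (Fin n) (Fin n) ℂ) : ℝ :=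
  Real.sqrt (Matrix.trace (star X * X)).re

theorem re_trace_mul_self_pos {ι : Type*} [Fintype ι] {A : Matrix ι ι ℂ} (hA : A.IsHermitian)
    (h0 : A ≠ 0) : 0 < (A * A).trace.re := by
  have h := Matrix.PosSemidef.trace_nonneg (Matrix.posSemidef_conjTranspose_mul_self A)
  have h' := mt (Matrix.trace_conjTranspose_mul_self_eq_zero_iff (A := A)).1 h0
  rw [hA.eq] at h h'
  exact (Complex.lt_def.1 (lt_of_le_of_ne h (Ne.symm h'))).1

theorem re_trace_mul_le {ι : Type*} [Fintype ι] {A B : Matrix ι ι ℂ} (hA : A.IsHermitian)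
    (hB : B.IsHermitian) {a b : ℝ} (ha : 0 < a) (hb : 0 < b) (haA : (A * A).trace.re = a ^ 2)
    (hbB : (B * B).trace.re = b ^ 2) : (A * B).trace.re ≤ a * b := by
  have hH : (b • A - a • B).IsHermitian := by
    simp [Matrix.IsHermitian, Matrix.conjTranspose_sub, Matrix.conjTranspose_smul, hA.eq, hB.eq]
  have h := Matrix.PosSemidef.trace_nonneg
    (Matrix.posSemidef_conjTranspose_mul_self (b • A - a • B))
  have h := (Complex.le_def.1 h).1
  rw [hH.eq] at h
  simp only [sub_mul, mul_sub, Matrix.trace_sub, Matrix.smul_mul, Matrix.mul_smul,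
    Matrix.trace_smul, Matrix.trace_mul_comm B A, Complex.sub_re, Complex.smul_re, smul_eq_mul,
    haA, hbB, Complex.zero_re] at h
  have : 0 ≤ (2 * (a * b)) * (a * b - (A * B).trace.re) := by linarith
  linarith [nonneg_of_mul_nonneg_right this (by positivity)]

section MatrixRpow

open scoped MatrixOrder Matrix.Norms.L2Operator

variable {ι : Type*} [Fintype ι] [DecidableEq ι]

theorem matFun_eq_cfc {n : ℕ} (A : Matrix (Fin n) (Fin n) ℂ) (hA : A.IsHermitian) (g : ℝ → ℝ) :
    matFun A hA g = cfc g A := by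
  rw [hA.cfc_eq, Matrix.IsHermitian.cfc, Unitary.conjStarAlgAut_apply]
  rfl

theorem mpow_eq_rpow {n : ℕ} (A : Matrix (Fin n) (Fin n) ℂ) (hA : A.IsHermitian) (hA0 : 0 ≤ A)
    (p : ℝ) : mpow A hA p = A ^ p := by
  rw [mpow, matFun_eq_cfc, CFC.rpow_eq_cfc_real]

theorem smul_rpow_rpow {A : Matrix ι ι ℂ} (hA : 0 ≤ A) {c p : ℝ} (hc : 0 ≤ c) (q : ℝ) :
    (c ^ p • A ^ p) ^ q = c ^ (p * q) • A ^ (p * q) := by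
  have hcont (f : ℝ → ℝ) : ContinuousOn f (spectrum ℝ A) :=
    (Matrix.finite_real_spectrum (A := A)).continuousOn f
  have h0 : 0 ≤ c ^ p • A ^ p := smul_nonneg (Real.rpow_nonneg hc p) CFC.rpow_nonneg
  have hsp : ∀ x ∈ spectrum ℝ A, 0 ≤ x := fun x hx => spectrum_nonneg_of_nonneg hA hx
  rw [CFC.rpow_eq_cfc_real h0, CFC.rpow_eq_cfc_real (a := A) (y := p) hA,
    ← cfc_smul _ _ A (hcont _), ← cfc_comp _ _ A hA.isSelfAdjoint
      (((Matrix.finite_real_spectrum (A := A)).image _).continuousOn _) (hcont _),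
    CFC.rpow_eq_cfc_real (a := A) hA, ← cfc_smul _ _ A (hcont _)]
  refine cfc_congr fun x hx => ?_
  simp only [smul_eq_mul, Function.comp_apply]
  rw [Real.mul_rpow (Real.rpow_nonneg hc p) (Real.rpow_nonneg (hsp x hx) p),
    Real.rpow_mul hc, Real.rpow_mul (hsp x hx)]

theorem re_trace_mul_le_of_le {A X Y : Matrix ι ι ℂ} (hA : 0 ≤ A) (h : X ≤ Y) :
    (A * X).trace.re ≤ (A * Y).trace.re := by
  obtain ⟨C, rfl⟩ := CStarAlgebra.nonneg_iff_eq_star_mul_self.1 hA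
  have := ((Matrix.le_iff.1 h).mul_mul_conjTranspose_same C).trace_nonneg
  rw [← Matrix.star_eq_conjTranspose, Matrix.trace_mul_cycle, mul_sub, Matrix.trace_sub] at this
  have := (Complex.le_def.1 this).1
  simp at this
  linarith

theorem re_trace_cfc {A : Matrix ι ι ℂ} (hA : A.IsHermitian) (f : ℝ → ℝ) :
    (cfc f A).trace.re = ∑ i, f (hA.eigenvalues i) := by
  rw [hA.cfc_eq, Matrix.IsHermitian.cfc, Unitary.conjStarAlgAut_apply, Matrix.trace_mul_cycle]
  simp [Matrix.trace]

theorem conj_cfc_apply_re {A : Matrix ι ι ℂ} (hA : A.IsHermitian) (f : ℝ → ℝ)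
    (U : Matrix ι ι ℂ) (i : ι) :
    ((star U * cfc f A * U) i i).re =
      ∑ j, Complex.normSq ((star U * (hA.eigenvectorUnitary : Matrix ι ι ℂ)) i j) *
        f (hA.eigenvalues j) := by
  have : star U * cfc f A * U = (star U * (hA.eigenvectorUnitary : Matrix ι ι ℂ)) *
      Matrix.diagonal (fun j => (f (hA.eigenvalues j) : ℂ)) *
      star (star U * (hA.eigenvectorUnitary : Matrix ι ι ℂ)) := by
    rw [hA.cfc_eq, Matrix.IsHermitian.cfc, Unitary.conjStarAlgAut_apply, star_mul, star_star]
    simp only [Matrix.mul_assoc]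
    rfl
  rw [this, Matrix.mul_apply, Complex.re_sum]
  refine Finset.sum_congr rfl fun j _ => ?_
  rw [Matrix.mul_diagonal, Matrix.star_apply, mul_right_comm, Complex.star_def, Complex.mul_conj,
    ← Complex.ofReal_mul, Complex.ofReal_re]

/-- Jensen's inequality for a diagonal entry of a Hermitian matrix in an orthonormal basis. -/
theorem map_conj_apply_re_le {A : Matrix ι ι ℂ} (hA : 0 ≤ A) {f : ℝ → ℝ}
    (hf : ConvexOn ℝ (Set.Ici 0) f) {U : Matrix ι ι ℂ} (hU : U ∈ unitary (Matrix ι ι ℂ)) (i : ι) :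
    0 ≤ ((star U * A * U) i i).re ∧
    f ((star U * A * U) i i).re ≤ ((star U * cfc f A * U) i i).re := by
  have hpsd := Matrix.nonneg_iff_posSemidef.1 hA
  have hH := hpsd.1
  have hW : ∑ j, Complex.normSq ((star U * (hH.eigenvectorUnitary : Matrix ι ι ℂ)) i j) = 1 := by
    have h := conj_cfc_apply_re hH (fun _ => 1) U i
    rw [cfc_const_one ℝ A hH.isSelfAdjoint, mul_one, Unitary.star_mul_self_of_mem hU] at h
    simpa using h.symm
  have hid := conj_cfc_apply_re hH (fun x => x) U i
  rw [cfc_id' ℝ A hH.isSelfAdjoint] at hid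
  rw [conj_cfc_apply_re hH f U i, hid]
  refine ⟨Finset.sum_nonneg fun j _ => mul_nonneg (Complex.normSq_nonneg _)
    (hpsd.eigenvalues_nonneg j), ?_⟩
  exact hf.map_sum_le (fun j _ => Complex.normSq_nonneg _) hW
    fun j _ => hpsd.eigenvalues_nonneg j

/-- The trace function `A ↦ trace (f A)` is convex when `f` is. -/
theorem re_trace_cfc_le {X Y : Matrix ι ι ℂ} (hX : 0 ≤ X) (hY : 0 ≤ Y) {f : ℝ → ℝ}
    (hf : ConvexOn ℝ (Set.Ici 0) f) {a b : ℝ} (ha : 0 ≤ a) (hb : 0 ≤ b) (hab : a + b = 1) :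
    (cfc f (a • X + b • Y)).trace.re ≤ a * (cfc f X).trace.re + b * (cfc f Y).trace.re := by
  have hM : 0 ≤ a • X + b • Y := add_nonneg (smul_nonneg ha hX) (smul_nonneg hb hY)
  have hH := (Matrix.nonneg_iff_posSemidef.1 hM).1
  set U : Matrix ι ι ℂ := (hH.eigenvectorUnitary).1 with hUdef
  have hU : U ∈ unitary (Matrix ι ι ℂ) := hH.eigenvectorUnitary.2
  have htr (Z : Matrix ι ι ℂ) : Z.trace.re = ∑ i, ((star U * Z * U) i i).re := by
    rw [← Complex.re_sum]
    change _ = (Matrix.trace (star U * Z * U)).re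
    rw [Matrix.trace_mul_cycle, Unitary.mul_star_self_of_mem hU, one_mul]
  have heig (i : ι) : hH.eigenvalues i =
      a * ((star U * X * U) i i).re + b * ((star U * Y * U) i i).re := by
    have h := conj_cfc_apply_re hH (fun x => x) U i
    rw [cfc_id' ℝ _ hH.isSelfAdjoint, ← hUdef, Unitary.star_mul_self_of_mem hU] at h
    simp only [Matrix.one_apply, apply_ite Complex.normSq, map_one, map_zero, ite_mul, one_mul,
      zero_mul, Finset.sum_ite_eq, Finset.mem_univ, if_true] at h
    rw [← h]
    simp [mul_add, add_mul]
  rw [re_trace_cfc hH, htr (cfc f X), htr (cfc f Y), Finset.mul_sum, Finset.mul_sum,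
    ← Finset.sum_add_distrib]
  refine Finset.sum_le_sum fun i _ => ?_
  obtain ⟨hx, hfx⟩ := map_conj_apply_re_le hX hf hU i
  obtain ⟨hy, hfy⟩ := map_conj_apply_re_le hY hf hU i
  rw [heig i]
  refine (hf.2 hx hy ha hb hab).trans ?_
  simp only [smul_eq_mul]
  gcongr

theorem re_trace_rpow_le {X Y : Matrix ι ι ℂ} (hX : 0 ≤ X) (hY : 0 ≤ Y) {s : ℝ} (hs : 1 ≤ s)
    {a b : ℝ} (ha : 0 ≤ a) (hb : 0 ≤ b) (hab : a + b = 1) :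
    ((a • X + b • Y) ^ s).trace.re ≤ a * (X ^ s).trace.re + b * (Y ^ s).trace.re := by
  have hM : 0 ≤ a • X + b • Y := add_nonneg (smul_nonneg ha hX) (smul_nonneg hb hY)
  rw [CFC.rpow_eq_cfc_real hX, CFC.rpow_eq_cfc_real hY, CFC.rpow_eq_cfc_real hM]
  exact re_trace_cfc_le hX hY (convexOn_rpow hs) ha hb hab

/-- The angle between `A` and the power mean of `A` and `B` is at most the angle between
`A` and `B`. -/
theorem re_trace_mul_sq_mul_le {A B : Matrix ι ι ℂ} (hA : 0 ≤ A) (hB : 0 ≤ B) (hA0 : A ≠ 0)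
    (hB0 : B ≠ 0) {p : ℝ} (hp1 : 1 ≤ p) (hp2 : p ≤ 2) {M : Matrix ι ι ℂ}
    (hM : M = ((1 : ℝ) / 2) • (A ^ p + B ^ p)) :
    (A * B).trace.re ^ 2 * (M ^ (1 / p) * M ^ (1 / p)).trace.re ≤
      (B * B).trace.re * (A * M ^ (1 / p)).trace.re ^ 2 := by
  have hp0 : 0 < p := by linarith
  have hAH := (Matrix.nonneg_iff_posSemidef.1 hA).1
  have hBH := (Matrix.nonneg_iff_posSemidef.1 hB).1
  obtain ⟨a, ha, haA⟩ : ∃ a : ℝ, 0 < a ∧ (A * A).trace.re = a ^ 2 :=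
    ⟨_, Real.sqrt_pos.2 (re_trace_mul_self_pos hAH hA0),
      (Real.sq_sqrt (re_trace_mul_self_pos hAH hA0).le).symm⟩
  obtain ⟨b, hb, hbB⟩ : ∃ b : ℝ, 0 < b ∧ (B * B).trace.re = b ^ 2 :=
    ⟨_, Real.sqrt_pos.2 (re_trace_mul_self_pos hBH hB0),
      (Real.sq_sqrt (re_trace_mul_self_pos hBH hB0).le).symm⟩
  have hC := re_trace_mul_le hAH hBH ha hb haA hbB
  have hC0 : 0 ≤ (A * B).trace.re := by
    simpa using re_trace_mul_le_of_le hA hB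
  have hap : 0 < a ^ p := Real.rpow_pos_of_pos ha p
  have hbp : 0 < b ^ p := Real.rpow_pos_of_pos hb p
  obtain ⟨r, hr, hrp⟩ : ∃ r : ℝ, 0 < r ∧ r ^ p = (a ^ p + b ^ p) / 2 :=
    ⟨((a ^ p + b ^ p) / 2) ^ p⁻¹, by positivity,
      Real.rpow_inv_rpow (by positivity) hp0.ne'⟩
  set u : ℝ := a ^ p / (a ^ p + b ^ p) with hu
  set v : ℝ := b ^ p / (a ^ p + b ^ p) with hv
  have hu0 : 0 ≤ u := by positivity
  have hv0 : 0 ≤ v := by positivity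
  have huv : u + v = 1 := by rw [hu, hv]; field_simp
  have hc : 0 ≤ r / a := by positivity
  have hd : 0 ≤ r / b := by positivity
  set X := (r / a) ^ p • A ^ p with hXdef
  set Y := (r / b) ^ p • B ^ p with hYdef
  have hX : 0 ≤ X := smul_nonneg (Real.rpow_nonneg hc p) CFC.rpow_nonneg
  have hY : 0 ≤ Y := smul_nonneg (Real.rpow_nonneg hd p) CFC.rpow_nonneg
  have hMXY : M = u • X + v • Y := by
    have h1 : u * (r / a) ^ p = 1 / 2 := by
      rw [hu, Real.div_rpow hr.le ha.le, hrp]; field_simp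
    have h2 : v * (r / b) ^ p = 1 / 2 := by
      rw [hv, Real.div_rpow hr.le hb.le, hrp]; field_simp
    rw [hM, hXdef, hYdef, smul_smul, smul_smul, h1, h2, smul_add]
  have hM0 : 0 ≤ M := hMXY ▸ add_nonneg (smul_nonneg hu0 hX) (smul_nonneg hv0 hY)
  have hlow : u • ((r / a) • A) + v • ((r / b) • B) ≤ M ^ (1 / p) := by
    have h := (CFC.concaveOn_rpow (A := Matrix ι ι ℂ) (p := 1 / p)
      ⟨by positivity, by rw [div_le_one hp0]; exact hp1⟩).2 hX hY hu0 hv0 huv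
    have hpp : p * (1 / p) = 1 := by field_simp
    simp only [hXdef, hYdef] at h
    rw [smul_rpow_rpow hA hc, smul_rpow_rpow hB hd, hpp, Real.rpow_one, Real.rpow_one,
      CFC.rpow_one A, CFC.rpow_one B] at h
    rwa [hMXY]
  have htr : (M ^ (1 / p) * M ^ (1 / p)).trace.re ≤ r ^ 2 := by
    have h := re_trace_rpow_le hX hY (s := 2 / p) (by rw [le_div_iff₀ hp0]; linarith) hu0 hv0 huv
    have hpp : p * (2 / p) = (2 : ℕ) := by push_cast; field_simp
    rw [← hMXY, hXdef, hYdef, smul_rpow_rpow hA hc, smul_rpow_rpow hB hd, hpp,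
      Real.rpow_natCast, Real.rpow_natCast, CFC.rpow_natCast A, CFC.rpow_natCast B, pow_two A,
      pow_two B, Matrix.trace_smul, Matrix.trace_smul, Complex.smul_re, Complex.smul_re, haA,
      hbB] at h
    have hsq : M ^ (1 / p) * M ^ (1 / p) = M ^ (2 / p) := by
      rw [← pow_two, ← CFC.rpow_natCast _ 2 CFC.rpow_nonneg,
        CFC.rpow_rpow_of_exponent_nonneg M _ _ (by positivity) (by positivity)]
      congr 1
      push_cast
      ring
    rw [hsq]
    refine h.trans_eq ?_
    simp only [smul_eq_mul]
    rw [div_pow, div_pow, div_mul_cancel₀ _ (by positivity), div_mul_cancel₀ _ (by positivity),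
      ← add_mul, huv, one_mul]
  have hAM : (r / b) * (A * B).trace.re ≤ (A * M ^ (1 / p)).trace.re := by
    refine le_trans ?_ (re_trace_mul_le_of_le hA hlow)
    simp only [mul_add, Matrix.mul_smul, Matrix.trace_add, Matrix.trace_smul, Complex.add_re,
      Complex.smul_re, smul_eq_mul, haA]
    have h1 : (r / b) * (A * B).trace.re ≤ (r / a) * a ^ 2 := by
      calc (r / b) * (A * B).trace.re ≤ (r / b) * (a * b) := by gcongr
        _ = (r / a) * a ^ 2 := by field_simp
    calc (r / b) * (A * B).trace.re
        = u * ((r / b) * (A * B).trace.re) + v * ((r / b) * (A * B).trace.re) := by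
          rw [← add_mul, huv, one_mul]
      _ ≤ _ := by gcongr
  rw [hbB]
  calc (A * B).trace.re ^ 2 * (M ^ (1 / p) * M ^ (1 / p)).trace.re
      ≤ (A * B).trace.re ^ 2 * r ^ 2 := by gcongr
    _ = b ^ 2 * ((r / b) * (A * B).trace.re) ^ 2 := by field_simp
    _ ≤ b ^ 2 * (A * M ^ (1 / p)).trace.re ^ 2 := by gcongr

end MatrixRpow

theorem stmt7 {n : ℕ} (A B : Matrix (Fin n) (Fin n) ℂ)
    (hA : A.PosDef) (hB : B.PosDef) (p : ℝ) (hp : p ∈ Set.Icc (1:ℝ) 2)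
    (hM : (((1:ℝ)/2) • (mpow A hA.1 p + mpow B hB.1 p)).IsHermitian) :
    (Matrix.trace (A * B)).re ^ 2 * (Matrix.trace (mpow _ hM (1/p) * mpow _ hM (1/p))).re ≤
      (Matrix.trace (B * B)).re * (Matrix.trace (A * mpow _ hM (1/p))).re ^ 2 := by
  open scoped MatrixOrder Matrix.Norms.L2Operator in
  rcases eq_or_ne n 0 with rfl | hn
  · simp [Matrix.trace]
  have : Nonempty (Fin n) := ⟨⟨0, Nat.pos_of_ne_zero hn⟩⟩
  have hA0 : 0 ≤ A := Matrix.nonneg_iff_posSemidef.2 hA.posSemidef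
  have hB0 : 0 ≤ B := Matrix.nonneg_iff_posSemidef.2 hB.posSemidef
  have hMr : ((1:ℝ)/2) • (mpow A hA.1 p + mpow B hB.1 p) = ((1:ℝ)/2) • (A ^ p + B ^ p) := by
    rw [mpow_eq_rpow A hA.1 hA0, mpow_eq_rpow B hB.1 hB0]
  have hM0 : 0 ≤ ((1:ℝ)/2) • (mpow A hA.1 p + mpow B hB.1 p) :=
    hMr ▸ smul_nonneg (by norm_num) (add_nonneg CFC.rpow_nonneg CFC.rpow_nonneg)
  have hne {C : Matrix (Fin n) (Fin n) ℂ} (hC : C.PosDef) : C ≠ 0 := fun h =>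
    hC.isUnit.ne_zero h
  rw [mpow_eq_rpow _ hM hM0]
  exact re_trace_mul_sq_mul_le hA0 hB0 (hne hA) (hne hB) hp.1 hp.2 hMr
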